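/- Let σ > 0 and A ≥ 0, and let X and Y be independent real-valued random variables, each distributed as a centered Gaussian with variance σ². Set ρ = √((A + X)² + Y²). Then for every t ≥ 0, ℙ(ρ ≤ t) = ∫₀^{t} (x/σ²)·exp(−(x² + A²)/(2σ²))·I₀(A·x/σ²) dx. -/

import Mathlib

open MeasureTheory ProbabilityTheory
open scoped ProbabilityTheory

/-- The zeroth-order modified Bessel function of the first kind,
`I₀ x = ∑' n, (x²/4)ⁿ / (n!)²`. -/
noncomputable def besselI0 (x : ℝ) : ℝ :=
  ∑' n : ℕ, (x ^ 2 / 4) ^ n / ((Nat.factorial n) ^ 2 : ℝ)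

theorem integral_cos_pow_even_symm (n : ℕ) :
    ∫ θ in (-Real.pi)..Real.pi, Real.cos θ ^ (2 * n) =
      2 * Real.pi * ((2 * n).factorial / (4 ^ n * (n.factorial : ℝ) ^ 2)) := by
  induction n with
  | zero => simp; ring
  | succ n ih =>
    rw [show 2 * (n + 1) = 2 * n + 2 by ring, integral_cos_pow, ih]
    simp only [Nat.factorial_succ, Real.sin_neg, Real.sin_pi]
    push_cast
    field_simp
    ring

theorem integral_cos_pow_odd_symm (n : ℕ) :
    ∫ θ in (-Real.pi)..Real.pi, Real.cos θ ^ (2 * n + 1) = 0 := by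
  induction n with
  | zero => simp
  | succ n ih =>
    rw [show 2 * (n + 1) + 1 = (2 * n + 1) + 2 by ring, integral_cos_pow, ih]
    simp

theorem integral_exp_mul_cos (x : ℝ) :
    ∫ θ in (-Real.pi)..Real.pi, Real.exp (x * Real.cos θ) = 2 * Real.pi * besselI0 x := by
  have hexp (y : ℝ) : HasSum (fun n : ℕ ↦ y ^ n / (n.factorial : ℝ)) (Real.exp y) := by
    rw [Real.exp_eq_exp_ℝ]
    exact NormedSpace.expSeries_div_hasSum_exp y
  have hsum : HasSum
      (fun n : ℕ ↦ ∫ θ in (-Real.pi)..Real.pi, (x * Real.cos θ) ^ n / (n.factorial : ℝ))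
      (∫ θ in (-Real.pi)..Real.pi, Real.exp (x * Real.cos θ)) := by
    refine intervalIntegral.hasSum_integral_of_dominated_convergence
      (fun n _ ↦ |x| ^ n / (n.factorial : ℝ)) (fun n ↦ ?_) (fun n ↦ ?_) ?_ ?_ ?_
    · exact (by fun_prop : Continuous fun θ : ℝ ↦
        (x * Real.cos θ) ^ n / (n.factorial : ℝ)).aestronglyMeasurable
    · refine .of_forall fun θ _ ↦ ?_
      rw [Real.norm_eq_abs, abs_div, abs_pow, abs_mul, Nat.abs_cast]
      gcongr
      exact mul_le_of_le_one_right (abs_nonneg x) (Real.abs_cos_le_one θ)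
    · exact .of_forall fun θ _ ↦ (hexp |x|).summable
    · simp
    · exact .of_forall fun θ _ ↦ hexp _
  have hterm (n : ℕ) : ∫ θ in (-Real.pi)..Real.pi, (x * Real.cos θ) ^ n / (n.factorial : ℝ) =
      x ^ n / n.factorial * ∫ θ in (-Real.pi)..Real.pi, Real.cos θ ^ n := by
    rw [← intervalIntegral.integral_const_mul]
    congr 1 with θ
    ring
  have hodd : ∀ n ∉ Set.range (fun k : ℕ ↦ 2 * k),
      ∫ θ in (-Real.pi)..Real.pi, (x * Real.cos θ) ^ n / (n.factorial : ℝ) = 0 := by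
    intro n hn
    obtain ⟨k, hk | hk⟩ := n.even_or_odd'
    · exact absurd ⟨k, hk.symm⟩ hn
    · rw [hterm, hk, integral_cos_pow_odd_symm, mul_zero]
  have hinj : Function.Injective (fun k : ℕ ↦ 2 * k) := fun a b h ↦ by simpa using h
  rw [← (hinj.hasSum_iff hodd).2 hsum |>.tsum_eq, besselI0, ← tsum_mul_left]
  congr 1 with n
  simp only [Function.comp_apply, hterm, integral_cos_pow_even_symm]
  rw [pow_mul, div_pow]
  field_simp

theorem besselI0_nonneg (x : ℝ) : 0 ≤ besselI0 x :=
  tsum_nonneg fun n ↦ by positivity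

theorem continuous_besselI0 : Continuous besselI0 := by
  have h : besselI0 = fun x ↦
      (2 * Real.pi)⁻¹ * ∫ θ in (-Real.pi)..Real.pi, Real.exp (x * Real.cos θ) := by
    ext x
    rw [integral_exp_mul_cos]
    field_simp
  rw [h]
  refine continuous_const.mul ?_
  apply intervalIntegral.continuous_parametric_intervalIntegral_of_continuous'
  fun_prop

theorem lintegral_exp_mul_cos (x : ℝ) :
    ∫⁻ θ in Set.Ioo (-Real.pi) Real.pi, ENNReal.ofReal (Real.exp (x * Real.cos θ)) =
      ENNReal.ofReal (2 * Real.pi * besselI0 x) := by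
  have hle : -Real.pi ≤ Real.pi := by linarith [Real.pi_pos]
  rw [← integral_exp_mul_cos, intervalIntegral.integral_of_le hle,
    restrict_Ioo_eq_restrict_Ioc, ofReal_integral_eq_lintegral_ofReal]
  · exact (by fun_prop : Continuous fun θ : ℝ ↦ Real.exp (x * Real.cos θ)).integrableOn_Ioc
  · exact .of_forall fun θ ↦ (Real.exp_pos _).le

/-- The product of Gaussian densities in polar coordinates, including the Jacobian. -/
theorem ofReal_mul_gaussianPDF_polar {σ : ℝ} (hσ : 0 < σ) (A : ℝ) {r : ℝ} (hr : 0 ≤ r) (θ : ℝ) :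
    ENNReal.ofReal r * (gaussianPDF A (σ ^ 2).toNNReal (r * Real.cos θ) *
        gaussianPDF 0 (σ ^ 2).toNNReal (r * Real.sin θ)) =
      ENNReal.ofReal
          ((2 * Real.pi)⁻¹ * (r / σ ^ 2 * Real.exp (-((r ^ 2 + A ^ 2) / (2 * σ ^ 2))))) *
        ENNReal.ofReal (Real.exp (A * r / σ ^ 2 * Real.cos θ)) := by
  rw [gaussianPDF, gaussianPDF, ← ENNReal.ofReal_mul (gaussianPDFReal_nonneg _ _ _),
    ← ENNReal.ofReal_mul hr, ← ENNReal.ofReal_mul (by positivity)]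
  congr 1
  simp only [gaussianPDFReal, Real.coe_toNNReal _ (sq_nonneg σ)]
  have hsqrt : (√(2 * Real.pi * σ ^ 2))⁻¹ * (√(2 * Real.pi * σ ^ 2))⁻¹ =
      (2 * Real.pi)⁻¹ / σ ^ 2 := by
    rw [← mul_inv, Real.mul_self_sqrt (by positivity)]
    field_simp
  have hexp : Real.exp (-(r * Real.cos θ - A) ^ 2 / (2 * σ ^ 2)) *
      Real.exp (-(r * Real.sin θ - 0) ^ 2 / (2 * σ ^ 2)) =
      Real.exp (-((r ^ 2 + A ^ 2) / (2 * σ ^ 2))) *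
        Real.exp (A * r / σ ^ 2 * Real.cos θ) := by
    rw [← Real.exp_add, ← Real.exp_add]
    congr 1
    field_simp
    linear_combination (-r ^ 2) * Real.sin_sq_add_cos_sq θ
  rw [mul_mul_mul_comm, hsqrt, hexp]
  ring

/-- The distribution function of the norm of a planar Gaussian vector with mean `(A, 0)`. -/
theorem gaussianReal_prod_sqrt_le {σ : ℝ} (hσ : 0 < σ) (A t : ℝ) :
    ((gaussianReal A (σ ^ 2).toNNReal).prod (gaussianReal 0 (σ ^ 2).toNNReal))
        {p : ℝ × ℝ | √(p.1 ^ 2 + p.2 ^ 2) ≤ t} =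
      ∫⁻ r in Set.Ioc 0 t, ENNReal.ofReal (r / σ ^ 2 *
        Real.exp (-((r ^ 2 + A ^ 2) / (2 * σ ^ 2))) * besselI0 (A * r / σ ^ 2)) := by
  have hv : (σ ^ 2).toNNReal ≠ 0 := by
    rw [Ne, Real.toNNReal_eq_zero, not_le]
    positivity
  have hS : MeasurableSet {p : ℝ × ℝ | √(p.1 ^ 2 + p.2 ^ 2) ≤ t} :=
    measurableSet_le (by fun_prop) measurable_const
  rw [gaussianReal_of_var_ne_zero _ hv, gaussianReal_of_var_ne_zero _ hv,
    prod_withDensity (by fun_prop) (by fun_prop), withDensity_apply _ hS,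
    ← lintegral_indicator hS, ← Measure.volume_eq_prod, ← lintegral_comp_polarCoord_symm]
  have hpolar : ∀ p ∈ polarCoord.target,
      ENNReal.ofReal p.1 • ({p : ℝ × ℝ | √(p.1 ^ 2 + p.2 ^ 2) ≤ t}.indicator
        (fun z ↦ gaussianPDF A (σ ^ 2).toNNReal z.1 * gaussianPDF 0 (σ ^ 2).toNNReal z.2)
        (polarCoord.symm p)) =
      (Set.Iic t).indicator (fun r ↦ ENNReal.ofReal
          ((2 * Real.pi)⁻¹ * (r / σ ^ 2 * Real.exp (-((r ^ 2 + A ^ 2) / (2 * σ ^ 2)))))) p.1 *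
        ENNReal.ofReal (Real.exp (A * p.1 / σ ^ 2 * Real.cos p.2)) := by
    rintro ⟨r, θ⟩ hp
    have hr : 0 < r := hp.1
    have hnorm : √((r * Real.cos θ) ^ 2 + (r * Real.sin θ) ^ 2) = r := by
      rw [show (r * Real.cos θ) ^ 2 + (r * Real.sin θ) ^ 2 = r ^ 2 by
        linear_combination r ^ 2 * Real.sin_sq_add_cos_sq θ, Real.sqrt_sq hr.le]
    by_cases hrt : r ≤ t
    · simp only [polarCoord_symm_apply, smul_eq_mul, Set.indicator, Set.mem_ofPred_eq, hnorm,
        Set.mem_Iic, hrt, if_true]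
      exact ofReal_mul_gaussianPDF_polar hσ A hr.le θ
    · simp [polarCoord_symm_apply, Set.indicator, hnorm, hrt]
  rw [setLIntegral_congr_fun polarCoord.open_target.measurableSet hpolar, polarCoord_target,
    Measure.volume_eq_prod, setLIntegral_prod]
  · have hinner (r : ℝ) : ∫⁻ θ in Set.Ioo (-Real.pi) Real.pi,
        (Set.Iic t).indicator (fun r ↦ ENNReal.ofReal
          ((2 * Real.pi)⁻¹ * (r / σ ^ 2 * Real.exp (-((r ^ 2 + A ^ 2) / (2 * σ ^ 2)))))) r *
        ENNReal.ofReal (Real.exp (A * r / σ ^ 2 * Real.cos θ)) =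
        (Set.Iic t).indicator (fun r ↦ ENNReal.ofReal (r / σ ^ 2 *
          Real.exp (-((r ^ 2 + A ^ 2) / (2 * σ ^ 2))) * besselI0 (A * r / σ ^ 2))) r := by
      rw [lintegral_const_mul _ (by fun_prop), lintegral_exp_mul_cos]
      by_cases hrt : r ≤ t
      · simp only [Set.indicator, Set.mem_Iic, hrt, if_true]
        rw [← ENNReal.ofReal_mul' (mul_nonneg (by positivity) (besselI0_nonneg _))]
        congr 1
        field_simp
      · simp [Set.indicator, hrt]
    simp only [hinner]
    rw [setLIntegral_indicator measurableSet_Iic, Set.inter_comm, Set.Ioi_inter_Iic]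
  · refine Measurable.aemeasurable (Measurable.mul ?_ (by fun_prop))
    exact (Measurable.indicator (by fun_prop) measurableSet_Iic).comp measurable_fst

theorem stmt_5 {Ω : Type*} [MeasureSpace Ω] [IsProbabilityMeasure (ℙ : Measure Ω)]
    (σ A : ℝ) (hσ : σ > 0) (hA : A ≥ 0)
    (X Y : Ω → ℝ) (hX : Measurable X) (hY : Measurable Y)
    (hindep : IndepFun X Y ℙ)
    (hXlaw : Measure.map X ℙ = gaussianReal 0 (Real.toNNReal (σ ^ 2)))
    (hYlaw : Measure.map Y ℙ = gaussianReal 0 (Real.toNNReal (σ ^ 2)))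
    (ρ : Ω → ℝ) (hρ : ρ = fun ω => Real.sqrt ((A + X ω) ^ 2 + (Y ω) ^ 2))
    (t : ℝ) (ht : t ≥ 0) :
    (ℙ {ω | ρ ω ≤ t}).toReal =
      ∫ x in (0 : ℝ)..t,
        (x / σ ^ 2) * Real.exp (-((x ^ 2 + A ^ 2) / (2 * σ ^ 2))) *
          besselI0 (A * x / σ ^ 2) := by
  have hset : {ω | ρ ω ≤ t} = (fun ω ↦ (A + X ω, Y ω)) ⁻¹'
      {p : ℝ × ℝ | √(p.1 ^ 2 + p.2 ^ 2) ≤ t} := by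
    rw [hρ]
    rfl
  have hshift : Measure.map (fun ω ↦ A + X ω) ℙ = gaussianReal A (σ ^ 2).toNNReal := by
    rw [← Function.comp_def (fun x ↦ A + x) X,
      ← Measure.map_map (measurable_const_add A) hX, hXlaw, gaussianReal_map_const_add, zero_add]
  have hindep' : IndepFun (fun ω ↦ A + X ω) Y ℙ :=
    hindep.comp (measurable_const_add A) measurable_id
  have hjoint := (indepFun_iff_map_prod_eq_prod_map_map
    (hX.const_add A).aemeasurable hY.aemeasurable).1 hindep'
  rw [hset, ← Measure.map_apply ((hX.const_add A).prodMk hY)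
      (measurableSet_le (by fun_prop) measurable_const), hjoint, hshift, hYlaw,
    gaussianReal_prod_sqrt_le hσ, intervalIntegral.integral_of_le ht,
    integral_eq_lintegral_of_nonneg_ae]
  · filter_upwards [ae_restrict_mem measurableSet_Ioc] with x hx
    have hx0 : 0 ≤ x := hx.1.le
    exact mul_nonneg (by positivity) (besselI0_nonneg _)
  · have := continuous_besselI0
    exact (by fun_prop : Continuous fun x : ℝ ↦ x / σ ^ 2 *
      Real.exp (-((x ^ 2 + A ^ 2) / (2 * σ ^ 2))) *
        besselI0 (A * x / σ ^ 2)).aestronglyMeasurable
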